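/- Evaluation formula for nonsymmetric Askey–Wilson polynomials: let m ∈ ℤ≥0 and suppose f ∈ L_F has the form f = 𝕏^{m+1} + Σ_{j=−m}^{m} c_j·𝕏^j (c_j ∈ F) and satisfies Ŷ(f) = (u₀·u₁)^{−1/2}·q^{−(m+1)/2}·f. Then the evaluation of f at 𝕏 = u₁^{−1/2}·v₁^{−1/2} equals (u₁·v₀·v₁)^{−(m+1)/2} · (∏_{j=1}^{m} (1 + q^{j/2}·u₁)) / (∏_{j=m+1}^{2m+1} (1 − q^{j/2}·u₀·u₁)) · ∏_{i=0}^{m} (v₀^{1/2} + q^{(2i+1)/4}·u₀^{1/2}·u₁^{1/2}·v₁^{1/2})·(1 − q^{(2i+1)/4}·u₀^{1/2}·u₁^{1/2}·v₀^{1/2}·v₁^{1/2}). -/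

import Mathlib

noncomputable section

/-- The field `F = ℚ(q^{1/4}, u₀^{1/2}, u₁^{1/2}, v₀^{1/2}, v₁^{1/2})` of rational
functions in five independent variables. -/
abbrev F : Type := FractionRing (MvPolynomial (Fin 5) ℚ)

namespace F
/-- `q^{1/4}` -/
def q4 : F := algebraMap (MvPolynomial (Fin 5) ℚ) F (MvPolynomial.X 0)
/-- `u₀^{1/2}` -/
def u0h : F := algebraMap (MvPolynomial (Fin 5) ℚ) F (MvPolynomial.X 1)
/-- `u₁^{1/2}` -/
def u1h : F := algebraMap (MvPolynomial (Fin 5) ℚ) F (MvPolynomial.X 2)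
/-- `v₀^{1/2}` -/
def v0h : F := algebraMap (MvPolynomial (Fin 5) ℚ) F (MvPolynomial.X 3)
/-- `v₁^{1/2}` -/
def v1h : F := algebraMap (MvPolynomial (Fin 5) ℚ) F (MvPolynomial.X 4)
/-- `q^{1/2}` -/
def q2 : F := q4 ^ 2
/-- `u₀` -/
def u0 : F := u0h ^ 2
/-- `u₁` -/
def u1 : F := u1h ^ 2
/-- `v₀` -/
def v0 : F := v0h ^ 2
/-- `v₁` -/
def v1 : F := v1h ^ 2
end F

/-- The Laurent polynomial ring `L_F = F[𝕏^{±1}]`. -/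
abbrev LF : Type := LaurentPolynomial F

/-- `𝕏₀ = q^{1/4}·𝕏⁻¹` and `𝕏₁ = 𝕏` -/
def Xl : Fin 2 → LF :=
  ![LaurentPolynomial.C F.q4 * LaurentPolynomial.T (-1), LaurentPolynomial.T 1]

def uh : Fin 2 → F := ![F.u0h, F.u1h]
def vh : Fin 2 → F := ![F.v0h, F.v1h]

/-- defining property of the operators `s₁, s₀`:
`s₁(𝕏^m) = 𝕏^{−m}` and `s₀(𝕏^m) = q^{m/2}·𝕏^{−m}`. -/
def Sconds (s : Fin 2 → Module.End F LF) : Prop :=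
  (∀ m : ℤ, s 1 (LaurentPolynomial.T m) = LaurentPolynomial.T (-m)) ∧
  (∀ m : ℤ, s 0 (LaurentPolynomial.T m) = (F.q2 ^ m) • LaurentPolynomial.T (-m))

/-- defining property of the Demazure–Lusztig operators `Û_i`:
`Û_i(f) = u_i^{1/2}·s_i(f) + ((u_i^{1/2} − u_i^{−1/2}) + (v_i^{1/2} − v_i^{−1/2})·𝕏_i)·g`
whenever `(1 − 𝕏_i²)·g = f − s_i(f)`. -/
def Uconds (s U : Fin 2 → Module.End F LF) : Prop :=
  ∀ (i : Fin 2) (f g : LF), (1 - Xl i ^ 2) * g = f - s i f →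
    U i f = uh i • s i f +
      (LaurentPolynomial.C (uh i - (uh i)⁻¹) +
        LaurentPolynomial.C (vh i - (vh i)⁻¹) * Xl i) * g

/-- defining property of the inverse operators `Û_i'`:
`Û_i'(f) = u_i^{−1/2}·s_i(f) + ((u_i^{1/2} − u_i^{−1/2})·𝕏_i² + (v_i^{1/2} − v_i^{−1/2})·𝕏_i)·g`
whenever `(1 − 𝕏_i²)·g = f − s_i(f)`. -/
def U'conds (s U' : Fin 2 → Module.End F LF) : Prop :=
  ∀ (i : Fin 2) (f g : LF), (1 - Xl i ^ 2) * g = f - s i f →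
    U' i f = (uh i)⁻¹ • s i f +
      (LaurentPolynomial.C (uh i - (uh i)⁻¹) * Xl i ^ 2 +
        LaurentPolynomial.C (vh i - (vh i)⁻¹) * Xl i) * g



/-- The data of a rank one Demazure–Lusztig operator `U` on a commutative algebra: `s` is an
involution exchanging `x` with its inverse `y`, and `U` is given by the usual divided difference
with parameters `u` and `b`. -/
structure IsDemazureLusztig {K R : Type*} [Field K] [CommRing R] [Algebra K R]
    (s U : Module.End K R) (x y : R) (u b : K) : Prop where
  mul_eq_one : x * y = 1
  map_x_mul : ∀ f, s (x * f) = y * s f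
  map_y_mul : ∀ f, s (y * f) = x * s f
  invol : ∀ f, s (s f) = f
  exists_quot : ∀ f, ∃ g, (1 - x ^ 2) * g = f - s f ∧ s g = x ^ 2 * g
  apply_eq : ∀ f g, (1 - x ^ 2) * g = f - s f → U f = u • s f + (u - u⁻¹) • g + b • (x * g)

namespace IsDemazureLusztig

variable {K R : Type*} [Field K] [CommRing R] [Algebra K R]
  {s U : Module.End K R} {x y : R} {u b : K}

theorem map_apply (h : IsDemazureLusztig s U x y u b) {f g : R}
    (hg : (1 - x ^ 2) * g = f - s f) (hsg : s g = x ^ 2 * g) :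
    s (U f) = u • f + (u - u⁻¹) • (x ^ 2 * g) + b • (x * g) := by
  rw [h.apply_eq f g hg, map_add, map_add, map_smul, map_smul, map_smul, h.invol, h.map_x_mul, hsg,
    show y * (x ^ 2 * g) = x * g by linear_combination x * g * h.mul_eq_one]

theorem algebraMap_mul_inv (hu : u ≠ 0) : algebraMap K R u * algebraMap K R u⁻¹ = 1 := by
  rw [← map_mul, mul_inv_cancel₀ hu, map_one]

/-- The quadratic Hecke relation. -/
theorem apply_apply (h : IsDemazureLusztig s U x y u b) (hu : u ≠ 0) (f : R) :
    U (U f) = (u - u⁻¹) • U f + f := by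
  obtain ⟨g, hg, hsg⟩ := h.exists_quot f
  have h1 := h.map_apply hg hsg
  have h2 := h.apply_eq f g hg
  have hc := algebraMap_mul_inv (R := R) hu
  have h3 : (1 - x ^ 2) * (-(u⁻¹ • g)) = U f - s (U f) := by
    rw [h1, h2]
    simp only [Algebra.smul_def, map_sub]
    linear_combination -(algebraMap K R u) * hg
  rw [h.apply_eq _ _ h3, h1, h2]
  simp only [Algebra.smul_def, map_sub]
  linear_combination f * hc - (algebraMap K R u - algebraMap K R u⁻¹) *
    (algebraMap K R u) * hg

/-- The quadratic Hecke relation for the operator `f ↦ x * U f`. -/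
theorem apply_x_mul_apply (h : IsDemazureLusztig s U x y u b) (hu : u ≠ 0) (f : R) :
    U (x * U f) = -(b • U f) + y * f := by
  obtain ⟨g, hg, hsg⟩ := h.exists_quot f
  have h1 := h.map_apply hg hsg
  have h2 := h.apply_eq f g hg
  have hc := algebraMap_mul_inv (R := R) hu
  have hxy := h.mul_eq_one
  have h3 : (1 - x ^ 2) * (-(u • (y * f)) - u • (x * g) - b • g) = x * U f - s (x * U f) := by
    rw [h.map_x_mul, h1, h2]
    simp only [Algebra.smul_def, map_sub]
    linear_combination (x * algebraMap K R u * f +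
      (algebraMap K R u - algebraMap K R u⁻¹) * x * g + algebraMap K R b * g) * hxy -
      algebraMap K R u * x * hg
  rw [h.apply_eq _ _ h3, h.map_x_mul, h1, h2]
  simp only [Algebra.smul_def, map_sub]
  linear_combination (algebraMap K R u * (algebraMap K R u - algebraMap K R u⁻¹) * x * g +
    algebraMap K R u * algebraMap K R b * g - algebraMap K R b * algebraMap K R u * f) * hxy +
    algebraMap K R b * algebraMap K R u * hg + y * f * hc

/-- `U` commutes with multiplication by the symmetric element `x + y`. -/
theorem apply_symm_mul (h : IsDemazureLusztig s U x y u b) (f : R) :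
    U ((x + y) * f) = (x + y) * U f := by
  obtain ⟨g, hg, -⟩ := h.exists_quot f
  have hs : s ((x + y) * f) = (x + y) * s f := by
    rw [add_mul, map_add, h.map_x_mul, h.map_y_mul]; ring
  rw [h.apply_eq f g hg, h.apply_eq _ ((x + y) * g) (by rw [hs]; linear_combination (x + y) * hg),
    hs]
  simp only [Algebra.smul_def]
  ring

theorem apply_of_map_eq (h : IsDemazureLusztig s U x y u b) {f : R} (hf : s f = f) :
    U f = u • f := by
  rw [h.apply_eq f 0 (by rw [hf]; ring), hf]
  simp

theorem map_x_pow (h : IsDemazureLusztig s U x y u b) (h1 : s 1 = 1) (n : ℕ) :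
    s (x ^ n) = y ^ n := by
  induction n with
  | zero => simpa using h1
  | succ n ih => rw [pow_succ', h.map_x_mul, ih, pow_succ']

theorem apply_x (h : IsDemazureLusztig s U x y u b) (h1 : s 1 = 1) :
    U x = u⁻¹ • y - b • 1 := by
  have hs : s x = y := by simpa using h.map_x_pow h1 1
  have hxy := h.mul_eq_one
  rw [h.apply_eq x (-y) (by rw [hs]; linear_combination x * hxy), hs]
  simp only [Algebra.smul_def, map_sub]
  linear_combination - (algebraMap K R b) * hxy

/-- Triangularity of `U` on powers of `x`, with respect to a filtration `L`. -/
theorem apply_x_pow_mem (h : IsDemazureLusztig s U x y u b) (h1 : s 1 = 1)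
    (L : ℕ → Submodule K R) (hL : Monotone L) (hL1 : 1 ∈ L 0)
    (hx : ∀ n, ∀ f ∈ L n, x * f ∈ L (n + 1)) (hy : ∀ n, ∀ f ∈ L n, y * f ∈ L (n + 1)) (n : ℕ) :
    U (x ^ n) ∈ L n ∧ U (x ^ (n + 1)) - u⁻¹ • y ^ (n + 1) ∈ L n := by
  have hyn (n : ℕ) : y ^ n ∈ L n := by
    induction n with
    | zero => simpa using hL1
    | succ n ih => rw [pow_succ']; exact hy n _ ih
  have hxy := h.mul_eq_one
  induction n with
  | zero =>
    refine ⟨?_, ?_⟩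
    · rw [pow_zero, h.apply_of_map_eq h1]
      exact Submodule.smul_mem _ _ hL1
    · rw [zero_add, pow_one, pow_one, h.apply_x h1, sub_sub_cancel_left, ← neg_smul]
      exact Submodule.smul_mem _ _ hL1
  | succ n ih =>
    obtain ⟨ih0, ih1⟩ := ih
    refine ⟨?_, ?_⟩
    · rw [← sub_add_cancel (U (x ^ (n + 1))) (u⁻¹ • y ^ (n + 1))]
      exact add_mem (hL n.le_succ ih1) (Submodule.smul_mem _ _ (hyn _))
    · have e : U (x ^ (n + 1 + 1)) = (x + y) * U (x ^ (n + 1)) - U (x ^ n) := by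
        rw [← h.apply_symm_mul, ← map_sub]
        congr 1
        linear_combination - x ^ n * hxy
      have e2 : U (x ^ (n + 1 + 1)) - u⁻¹ • y ^ (n + 1 + 1) =
          x * (U (x ^ (n + 1)) - u⁻¹ • y ^ (n + 1)) + y * (U (x ^ (n + 1)) - u⁻¹ • y ^ (n + 1))
            + u⁻¹ • y ^ n - U (x ^ n) := by
        rw [e]
        simp only [Algebra.smul_def]
        linear_combination (algebraMap K R u⁻¹) * y ^ n * hxy
      rw [e2]
      exact sub_mem (add_mem (add_mem (hx _ _ ih1) (hy _ _ ih1))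
        (Submodule.smul_mem _ _ (hL n.le_succ (hyn n)))) (hL n.le_succ ih0)

theorem apply_y_pow (h : IsDemazureLusztig s U x y u b) (h1 : s 1 = 1) (n : ℕ) :
    U (y ^ n) = u • (x ^ n + y ^ n) - U (x ^ n) := by
  have hx := h.map_x_pow h1 n
  rw [← h.apply_of_map_eq (by rw [map_add, hx, ← hx, h.invol, hx, add_comm]), map_add]
  abel

/-- Evaluation at `x = (u v)⁻¹` turns `U` into the scalar `u`. -/
theorem eval_apply {v : K} (h : IsDemazureLusztig s U x y u (v - v⁻¹)) (hu : u ≠ 0) (hv : v ≠ 0)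
    (ev : R →ₐ[K] K) (hev : ev x = (u * v)⁻¹) (f : R) : ev (U f) = u * ev f := by
  obtain ⟨g, hg, -⟩ := h.exists_quot f
  have h1 := congrArg ev hg
  simp only [map_mul, map_sub, map_one, map_pow, hev] at h1
  rw [h.apply_eq f g hg]
  simp only [map_add, map_smul, map_mul, hev, smul_eq_mul]
  have h2 : ev (s f) = ev f - (1 - (u * v)⁻¹ ^ 2) * ev g := by linear_combination h1
  rw [h2]
  field_simp
  ring

section Intertwiners

variable {s₀ s₁ U₀ U₁ : Module.End K R} {x₀ y₀ x₁ y₁ : R} {u₀ b₀ u₁ b₁ k : K}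

/-- The intertwiner exchanging the eigenvalues `l` and `l⁻¹` of `U₀ U₁`. -/
theorem intertwine_inv (h₀ : IsDemazureLusztig s₀ U₀ x₀ y₀ u₀ b₀)
    (h₁ : IsDemazureLusztig s₁ U₁ x₁ y₁ u₁ b₁) (hu₀ : u₀ ≠ 0) (hu₁ : u₁ ≠ 0) {l β : K}
    (hl : l ≠ 0) (hβ : (u₁ - u₁⁻¹) * l + (u₀ - u₀⁻¹) + β * l = l⁻¹ * β)
    {f : R} (hf : U₀ (U₁ f) = l • f) :
    U₀ (U₁ (U₁ f + β • f)) = l⁻¹ • (U₁ f + β • f) := by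
  have e := h₀.apply_apply hu₀ (U₁ f)
  rw [hf, map_smul] at e
  have e' : U₀ f = (u₀ - u₀⁻¹) • f + l⁻¹ • U₁ f := by
    rw [← inv_smul_smul₀ hl (U₀ f), e]
    match_scalars <;> field_simp
  rw [map_add, h₁.apply_apply hu₁, map_smul, map_add, map_add, map_smul, map_smul, hf, e',
    smul_add, smul_smul l⁻¹ β, ← hβ]
  module

/-- The intertwiner exchanging the eigenvalues `l` and `(k² l)⁻¹` of `U₀ U₁`. -/
theorem intertwine_shift (h₀ : IsDemazureLusztig s₀ U₀ x₀ y₀ u₀ b₀)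
    (h₁ : IsDemazureLusztig s₁ U₁ x₁ y₁ u₁ b₁) (hu₀ : u₀ ≠ 0) (hu₁ : u₁ ≠ 0) (hk : k ≠ 0)
    (hx : x₀ = k • y₁) (hy : y₀ = k⁻¹ • x₁) {l β : K}
    (hl : l ≠ 0) (hβ : -(b₁ * l) - b₀ * k⁻¹ + β * l = (k ^ 2 * l)⁻¹ * β)
    {f : R} (hf : U₀ (U₁ f) = l • f) :
    U₀ (U₁ (x₁ * U₁ f + β • f)) = (k ^ 2 * l)⁻¹ • (x₁ * U₁ f + β • f) := by
  have e := h₀.apply_x_mul_apply hu₀ (U₁ f)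
  rw [hf, hx, hy, smul_mul_smul_comm, map_smul, smul_mul_assoc] at e
  have e' : U₀ (y₁ * f) = -((b₀ * k⁻¹) • f) + (k ^ 2 * l)⁻¹ • (x₁ * U₁ f) := by
    rw [← inv_smul_smul₀ (mul_ne_zero hk hl) (U₀ (y₁ * f)), e]
    match_scalars <;> field_simp
  rw [map_add, h₁.apply_x_mul_apply hu₁, map_smul, map_add, map_add, map_neg, map_smul, map_smul,
    hf, e', smul_add, smul_smul (k ^ 2 * l)⁻¹ β, ← hβ]
  module

end Intertwiners

end IsDemazureLusztig

namespace LaurentPolynomial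

variable {K : Type*} [Field K]

/-- The Laurent polynomials whose exponents lie in the interval `[a, b]`. -/
def spanIcc (K : Type*) [Field K] (a b : ℤ) : Submodule K (LaurentPolynomial K) :=
  Submodule.span K (T '' Set.Icc a b)

theorem T_mem_spanIcc {a b j : ℤ} (ha : a ≤ j) (hb : j ≤ b) : T j ∈ spanIcc K a b :=
  Submodule.subset_span ⟨j, ⟨ha, hb⟩, rfl⟩

theorem map_mem_of_mem_spanIcc {M : Type*} [AddCommGroup M] [Module K M] {a b : ℤ}
    (P : Submodule K M) (φ : LaurentPolynomial K →ₗ[K] M)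
    (h : ∀ j, a ≤ j → j ≤ b → φ (T j) ∈ P) {f : LaurentPolynomial K} (hf : f ∈ spanIcc K a b) :
    φ f ∈ P := by
  have : spanIcc K a b ≤ P.comap φ := by
    rw [spanIcc, Submodule.span_le]
    rintro _ ⟨j, ⟨ha, hb⟩, rfl⟩
    exact h j ha hb
  exact this hf

theorem spanIcc_mono {a b a' b' : ℤ} (ha : a' ≤ a) (hb : b ≤ b') :
    spanIcc K a b ≤ spanIcc K a' b' :=
  Submodule.span_mono (Set.image_mono (Set.Icc_subset_Icc ha hb))

theorem T_mul_mem_spanIcc {a b a' b' : ℤ} (n : ℤ) (ha : a' ≤ n + a) (hb : n + b ≤ b')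
    {f : LaurentPolynomial K} (hf : f ∈ spanIcc K a b) : T n * f ∈ spanIcc K a' b' := by
  refine map_mem_of_mem_spanIcc _ (LinearMap.mulLeft K (T n)) (fun j h1 h2 => ?_) hf
  rw [LinearMap.mulLeft_apply, ← T_add]
  exact T_mem_spanIcc (by lia) (by lia)

theorem coeff_of_mem_spanIcc {a b n : ℤ} (hn : n < a ∨ b < n) {f : LaurentPolynomial K}
    (hf : f ∈ spanIcc K a b) : f.coeff n = 0 := by
  refine Submodule.span_induction (p := fun f _ => f.coeff n = 0) ?_ ?_ ?_ ?_ hf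
  · rintro _ ⟨j, ⟨h1, h2⟩, rfl⟩
    rw [T_apply, if_neg (by lia)]
  · simp
  · intro f g _ _ h1 h2
    simp [h1, h2]
  · intro c f _ h
    simp [h]

theorem exists_of_mem_spanIcc_succ {n : ℕ} {f : LaurentPolynomial K}
    (hf : f ∈ spanIcc K (-((n : ℤ) + 1)) (n + 1)) :
    ∃ a b : K, ∃ r ∈ spanIcc K (-(n : ℤ)) n, f = a • T (-((n : ℤ) + 1)) + b • T ((n : ℤ) + 1) + r := by
  refine Submodule.span_induction (p := fun f _ => ∃ a b : K, ∃ r ∈ spanIcc K (-(n : ℤ)) n,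
    f = a • T (-((n : ℤ) + 1)) + b • T ((n : ℤ) + 1) + r) ?_ ?_ ?_ ?_ hf
  · rintro _ ⟨j, ⟨h1, h2⟩, rfl⟩
    rcases h1.eq_or_lt with rfl | h1
    · exact ⟨1, 0, 0, zero_mem _, by simp⟩
    rcases h2.eq_or_lt with rfl | h2
    · exact ⟨0, 1, 0, zero_mem _, by simp⟩
    · exact ⟨0, 0, T j, T_mem_spanIcc (by lia) (by lia), by simp⟩
  · exact ⟨0, 0, 0, zero_mem _, by simp⟩
  · rintro f g _ _ ⟨a, b, r, hr, rfl⟩ ⟨a', b', r', hr', rfl⟩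
    exact ⟨a + a', b + b', r + r', add_mem hr hr', by module⟩
  · rintro c f _ ⟨a, b, r, hr, rfl⟩
    exact ⟨c * a, c * b, c • r, Submodule.smul_mem _ _ hr, by module⟩

theorem eq_zero_of_top_add_mem {n : ℕ} {a b : K} {r : LaurentPolynomial K}
    (hr : r ∈ spanIcc K (-(n : ℤ)) n)
    (h : a • T (-((n : ℤ) + 1)) + b • T ((n : ℤ) + 1) + r = 0) : a = 0 ∧ b = 0 := by
  have h1 := congrArg (fun f => f.coeff (-((n : ℤ) + 1))) h
  have h2 := congrArg (fun f => f.coeff ((n : ℤ) + 1)) h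
  simp only [AddMonoidAlgebra.coeff_add, AddMonoidAlgebra.coeff_smul, Finsupp.add_apply, Finsupp.smul_apply, T_apply] at h1 h2
  rw [coeff_of_mem_spanIcc (by lia) hr] at h1 h2
  rw [if_neg (by lia : ¬ (n : ℤ) + 1 = -(n + 1))] at h1
  rw [if_neg (by lia : ¬ -((n : ℤ) + 1) = n + 1)] at h2
  simpa using And.intro h1 h2

theorem apply_T_mul_of_flip {s : Module.End K (LaurentPolynomial K)} {d : K} (hd : d ≠ 0)
    (hs : ∀ n : ℤ, s (T n) = d ^ n • T (-n)) (m : ℤ) (f : LaurentPolynomial K) :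
    s (T m * f) = d ^ m • (T (-m) * s f) := by
  induction f using LaurentPolynomial.induction_on' with
  | add p q hp hq => rw [mul_add, map_add, hp, hq, map_add, mul_add, smul_add]
  | C_mul_T n a =>
    rw [← smul_eq_C_mul, mul_smul_comm, map_smul, map_smul, ← T_add, hs, hs, mul_smul_comm,
      mul_smul_comm, ← T_add, neg_add, zpow_add₀ hd]
    module

theorem apply_apply_of_flip {s : Module.End K (LaurentPolynomial K)} {d : K} (hd : d ≠ 0)
    (hs : ∀ n : ℤ, s (T n) = d ^ n • T (-n)) (f : LaurentPolynomial K) : s (s f) = f := by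
  induction f using LaurentPolynomial.induction_on' with
  | add p q hp hq => rw [map_add, map_add, hp, hq]
  | C_mul_T n a =>
    rw [← smul_eq_C_mul, map_smul, map_smul, hs, map_smul, hs, neg_neg, smul_smul (d ^ n),
      ← zpow_add₀ hd, add_neg_cancel, zpow_zero, one_smul]

/-- A submodule containing `1` and stable under multiplication by `T 1` and `T (-1)` is
everything. -/
theorem mem_of_stable (D : Submodule K (LaurentPolynomial K)) (h1 : 1 ∈ D)
    (hpos : ∀ f ∈ D, T 1 * f ∈ D) (hneg : ∀ f ∈ D, T (-1) * f ∈ D) (f : LaurentPolynomial K) :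
    f ∈ D := by
  have hT (n : ℤ) : (T n : LaurentPolynomial K) ∈ D := by
    induction n with
    | zero => exact h1
    | succ n ih => rw [add_comm, T_add]; exact hpos _ ih
    | pred n ih => rw [sub_eq_neg_add, T_add]; exact hneg _ ih
  induction f using LaurentPolynomial.induction_on' with
  | add p q hp hq => exact add_mem hp hq
  | C_mul_T n a => rw [← smul_eq_C_mul]; exact Submodule.smul_mem _ _ (hT n)

theorem exists_quot_of_flip {s : Module.End K (LaurentPolynomial K)} {x y : LaurentPolynomial K}
    {c : K} {e : ℤ} (he : e = 1 ∨ e = -1) (hc : c ≠ 0) (hx : x = c • T e) (hy : y = c⁻¹ • T (-e))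
    (hxy : x * y = 1) (hsx : ∀ f, s (x * f) = y * s f) (hsy : ∀ f, s (y * f) = x * s f)
    (hss : ∀ f, s (s f) = f) (h1 : s 1 = 1) (f : LaurentPolynomial K) :
    ∃ g, (1 - x ^ 2) * g = f - s f ∧ s g = x ^ 2 * g := by
  let D : Submodule K (LaurentPolynomial K) :=
    { carrier := {f | ∃ g, (1 - x ^ 2) * g = f - s f ∧ s g = x ^ 2 * g}
      zero_mem' := ⟨0, by simp, by simp⟩
      add_mem' := by
        rintro f f' ⟨g, h1, h2⟩ ⟨g', h1', h2'⟩
        refine ⟨g + g', ?_, ?_⟩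
        · rw [mul_add, h1, h1', map_add]; abel
        · rw [mul_add, map_add, h2, h2']
      smul_mem' := by
        rintro a f ⟨g, h1, h2⟩
        refine ⟨a • g, ?_, ?_⟩
        · rw [mul_smul_comm, h1, map_smul, smul_sub]
        · rw [mul_smul_comm, map_smul, h2] }
  have hDx : ∀ f ∈ D, x * f ∈ D := by
    rintro f ⟨g, h1, h2⟩
    refine ⟨x * g - y * s f, ?_, ?_⟩
    · rw [hsx]; linear_combination x * h1 + x * s f * hxy
    · rw [map_sub, hsx, hsy, hss, h2]; linear_combination x * h1 + (x * g + x * s f) * hxy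
  have hDy : ∀ f ∈ D, y * f ∈ D := by
    rintro f ⟨g, h1, h2⟩
    refine ⟨y * g + y * s f, ?_, ?_⟩
    · rw [hsy]; linear_combination y * h1 - x * s f * hxy
    · rw [map_add, hsy, hsy, hss, h2]; linear_combination -x * h1 - (x * g + x * s f) * hxy
  have hTe : ∀ f ∈ D, T e * f ∈ D := fun f hf => by
    have h := D.smul_mem c⁻¹ (hDx f hf)
    rwa [hx, smul_mul_assoc, inv_smul_smul₀ hc] at h
  have hTe' : ∀ f ∈ D, T (-e) * f ∈ D := fun f hf => by
    have h := D.smul_mem c (hDy f hf)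
    rwa [hy, smul_mul_assoc, smul_inv_smul₀ hc] at h
  refine mem_of_stable D ⟨0, by simp [h1], by simp⟩ ?_ ?_ f
  · rcases he with rfl | rfl
    · exact hTe
    · simpa using hTe'
  · rcases he with rfl | rfl
    · exact hTe'
    · exact hTe

/-- Divided difference operators attached to the flip `T n ↦ d ^ n • T (-n)` are
Demazure–Lusztig operators. -/
theorem isDemazureLusztig_of_flip {s U : Module.End K (LaurentPolynomial K)}
    {x y : LaurentPolynomial K} {c d u b : K} {e : ℤ} (he : e = 1 ∨ e = -1) (hc : c ≠ 0)
    (hd : d ≠ 0) (hcd : c * d ^ e = c⁻¹) (hx : x = c • T e) (hy : y = c⁻¹ • T (-e))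
    (hs : ∀ n : ℤ, s (T n) = d ^ n • T (-n))
    (hU : ∀ f g, (1 - x ^ 2) * g = f - s f → U f = u • s f + (u - u⁻¹) • g + b • (x * g)) :
    IsDemazureLusztig s U x y u b := by
  have hxy : x * y = 1 := by
    rw [hx, hy, smul_mul_smul_comm, ← T_add, mul_inv_cancel₀ hc, add_neg_cancel, T_zero, one_smul]
  have hsx (f) : s (x * f) = y * s f := by
    rw [hx, hy, smul_mul_assoc, map_smul, apply_T_mul_of_flip hd hs, smul_smul, hcd,
      smul_mul_assoc]
  have hss := apply_apply_of_flip hd hs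
  have hsy (f) : s (y * f) = x * s f := by
    rw [← hss (x * s f), hsx, hss]
  exact ⟨hxy, hsx, hsy, hss, exists_quot_of_flip he hc hx hy hxy hsx hsy hss (by simpa using hs 0),
    hU⟩

end LaurentPolynomial

namespace IsDemazureLusztig

open LaurentPolynomial

variable {K : Type*} [Field K] {s U : Module.End K (LaurentPolynomial K)}
  {x y : LaurentPolynomial K} {c u b : K} {e : ℤ}

theorem apply_T_mem_spanIcc (h : IsDemazureLusztig s U x y u b) (he : e = 1 ∨ e = -1) (hc : c ≠ 0)
    (hx : x = c • T e) (hy : y = c⁻¹ • T (-e)) (h1 : s 1 = 1) (n : ℕ) :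
    U (T (e * n)) ∈ spanIcc K (-(n : ℤ)) n ∧
      U (T (e * (n + 1))) - (u * c ^ (2 * (n + 1)))⁻¹ • T (-(e * (n + 1))) ∈
        spanIcc K (-(n : ℤ)) n := by
  have key := h.apply_x_pow_mem h1 (fun n => spanIcc K (-(n : ℤ)) n)
    (fun m n hmn => spanIcc_mono (by lia) (by lia)) (by
      rw [← T_zero]; exact T_mem_spanIcc (by simp) (by simp))
    (fun n f hf => by
      rw [hx, smul_mul_assoc]
      exact Submodule.smul_mem _ _ (T_mul_mem_spanIcc _ (by lia) (by lia) hf))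
    (fun n f hf => by
      rw [hy, smul_mul_assoc]
      exact Submodule.smul_mem _ _ (T_mul_mem_spanIcc _ (by lia) (by lia) hf)) n
  have hxn (n : ℕ) : x ^ n = c ^ n • T (e * n) := by rw [hx, smul_pow, T_pow, mul_comm]
  have hyn (n : ℕ) : y ^ n = (c ^ n)⁻¹ • T (-(e * n)) := by
    rw [hy, smul_pow, T_pow, inv_pow]; congr 2; ring
  obtain ⟨k1, k2⟩ := key
  constructor
  · rwa [hxn, map_smul, Submodule.smul_mem_iff _ (pow_ne_zero _ hc)] at k1
  · rw [hxn, hyn, map_smul] at k2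
    have k3 := Submodule.smul_mem _ (c ^ (n + 1))⁻¹ k2
    rw [smul_sub, inv_smul_smul₀ (pow_ne_zero _ hc), smul_smul, smul_smul] at k3
    push_cast at k3
    convert k3 using 3
    rw [mul_inv, two_mul, pow_add, mul_inv]
    ring

theorem apply_T_neg (h : IsDemazureLusztig s U x y u b) (hc : c ≠ 0)
    (hx : x = c • T e) (hy : y = c⁻¹ • T (-e)) (h1 : s 1 = 1) (n : ℕ) :
    U (T (-(e * n))) = (u * c ^ (2 * n)) • T (e * n) + u • T (-(e * n)) -
      c ^ (2 * n) • U (T (e * n)) := by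
  have key := h.apply_y_pow h1 n
  have hxn : x ^ n = c ^ n • T (e * n) := by rw [hx, smul_pow, T_pow, mul_comm]
  have hyn : y ^ n = (c ^ n)⁻¹ • T (-(e * n)) := by
    rw [hy, smul_pow, T_pow, inv_pow]; congr 2; ring
  rw [hxn, hyn, map_smul, map_smul] at key
  rw [← smul_inv_smul₀ (pow_ne_zero n hc) (U (T (-(e * n)))), key, two_mul, pow_add]
  match_scalars <;> field_simp

theorem apply_T_neg_sub_mem_spanIcc (h : IsDemazureLusztig s U x y u b) (he : e = 1 ∨ e = -1)
    (hc : c ≠ 0) (hx : x = c • T e) (hy : y = c⁻¹ • T (-e)) (h1 : s 1 = 1) (n : ℕ) :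
    U (T (-(e * (n + 1)))) -
      ((u * c ^ (2 * (n + 1))) • T (e * (n + 1)) + (u - u⁻¹) • T (-(e * (n + 1)))) ∈
        spanIcc K (-(n : ℤ)) n := by
  have h2 := h.apply_T_neg hc hx hy h1 (n + 1)
  have h3 := Submodule.smul_mem _ (-c ^ (2 * (n + 1)))
    (h.apply_T_mem_spanIcc he hc hx hy h1 n).2
  push_cast at h2
  convert h3 using 1
  rw [h2]
  match_scalars <;> field_simp <;> ring

theorem apply_mem_spanIcc (h : IsDemazureLusztig s U x y u b) (he : e = 1 ∨ e = -1)
    (hc : c ≠ 0) (hx : x = c • T e) (hy : y = c⁻¹ • T (-e)) (h1 : s 1 = 1) (n : ℕ)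
    {f : LaurentPolynomial K} (hf : f ∈ spanIcc K (-(n : ℤ)) n) :
    U f ∈ spanIcc K (-(n : ℤ)) n := by
  refine map_mem_of_mem_spanIcc _ U (fun j hj hj' => ?_) hf
  obtain ⟨i, hi⟩ : ∃ i : ℕ, j = e * i ∨ j = -(e * i) :=
    ⟨j.natAbs, by rcases he with rfl | rfl <;> lia⟩
  have hin : i ≤ n := by rcases he with rfl | rfl <;> lia
  have hmono : spanIcc K (-(i : ℤ)) i ≤ spanIcc K (-(n : ℤ)) n :=
    spanIcc_mono (by lia) (by lia)
  have hU := hmono (h.apply_T_mem_spanIcc he hc hx hy h1 i).1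
  rcases hi with rfl | rfl
  · exact hU
  · rw [h.apply_T_neg hc hx hy h1]
    refine sub_mem (add_mem (Submodule.smul_mem _ _ (T_mem_spanIcc ?_ ?_))
      (Submodule.smul_mem _ _ (T_mem_spanIcc ?_ ?_))) (Submodule.smul_mem _ _ hU)
    all_goals rcases he with rfl | rfl <;> lia

end IsDemazureLusztig

open LaurentPolynomial in
/-- A pair of Demazure–Lusztig operators on Laurent polynomials generating the basic
representation of the double affine Hecke algebra of type `(C₁^∨, C₁)`, with generic
parameters. -/
structure IsAskeyWilsonPair {K : Type*} [Field K] (s₀ s₁ U₀ U₁ : Module.End K (LaurentPolynomial K))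
    (k u₀ u₁ v₀ v₁ : K) : Prop where
  isDL₀ : IsDemazureLusztig s₀ U₀ (k • T (-1)) (k⁻¹ • T 1) u₀ (v₀ - v₀⁻¹)
  isDL₁ : IsDemazureLusztig s₁ U₁ (T 1) (T (-1)) u₁ (v₁ - v₁⁻¹)
  map_one₀ : s₀ 1 = 1
  map_one₁ : s₁ 1 = 1
  k_ne : k ≠ 0
  u₀_ne : u₀ ≠ 0
  u₁_ne : u₁ ≠ 0
  v₀_ne : v₀ ≠ 0
  v₁_ne : v₁ ≠ 0
  generic_u : ∀ n : ℕ, k ^ (2 * n) * (u₀ * u₁) ^ 2 ≠ 1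
  generic_k : ∀ n : ℕ, k ^ (2 * (n + 1)) ≠ 1

namespace IsAskeyWilsonPair

open LaurentPolynomial

variable {K : Type*} [Field K] {s₀ s₁ U₀ U₁ : Module.End K (LaurentPolynomial K)}
  {k u₀ u₁ v₀ v₁ : K}

theorem U₀_mem (h : IsAskeyWilsonPair s₀ s₁ U₀ U₁ k u₀ u₁ v₀ v₁) (n : ℕ) {f : LaurentPolynomial K}
    (hf : f ∈ spanIcc K (-(n : ℤ)) n) : U₀ f ∈ spanIcc K (-(n : ℤ)) n :=
  h.isDL₀.apply_mem_spanIcc (.inr rfl) h.k_ne rfl (by rw [neg_neg]) h.map_one₀ n hf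

theorem U₁_mem (h : IsAskeyWilsonPair s₀ s₁ U₀ U₁ k u₀ u₁ v₀ v₁) (n : ℕ) {f : LaurentPolynomial K}
    (hf : f ∈ spanIcc K (-(n : ℤ)) n) : U₁ f ∈ spanIcc K (-(n : ℤ)) n :=
  h.isDL₁.apply_mem_spanIcc (.inl rfl) one_ne_zero (one_smul _ _).symm (by simp) h.map_one₁ n hf

theorem U₀_T_neg (h : IsAskeyWilsonPair s₀ s₁ U₀ U₁ k u₀ u₁ v₀ v₁) (n : ℕ) :
    U₀ (T (-((n : ℤ) + 1))) - (u₀ * k ^ (2 * (n + 1)))⁻¹ • T ((n : ℤ) + 1) ∈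
      spanIcc K (-(n : ℤ)) n := by
  simpa only [neg_one_mul, neg_neg] using
    (h.isDL₀.apply_T_mem_spanIcc (.inr rfl) h.k_ne rfl (by rw [neg_neg]) h.map_one₀ n).2

theorem U₀_T (h : IsAskeyWilsonPair s₀ s₁ U₀ U₁ k u₀ u₁ v₀ v₁) (n : ℕ) :
    U₀ (T ((n : ℤ) + 1)) - ((u₀ * k ^ (2 * (n + 1))) • T (-((n : ℤ) + 1)) +
      (u₀ - u₀⁻¹) • T ((n : ℤ) + 1)) ∈ spanIcc K (-(n : ℤ)) n := by
  simpa only [neg_one_mul, neg_neg] using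
    h.isDL₀.apply_T_neg_sub_mem_spanIcc (.inr rfl) h.k_ne rfl (by rw [neg_neg]) h.map_one₀ n

theorem U₁_T (h : IsAskeyWilsonPair s₀ s₁ U₀ U₁ k u₀ u₁ v₀ v₁) (n : ℕ) :
    U₁ (T ((n : ℤ) + 1)) - u₁⁻¹ • T (-((n : ℤ) + 1)) ∈ spanIcc K (-(n : ℤ)) n := by
  simpa only [one_mul, one_pow, mul_one] using
    (h.isDL₁.apply_T_mem_spanIcc (.inl rfl) one_ne_zero (one_smul _ _).symm (by simp)
      h.map_one₁ n).2

theorem U₁_T_neg (h : IsAskeyWilsonPair s₀ s₁ U₀ U₁ k u₀ u₁ v₀ v₁) (n : ℕ) :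
    U₁ (T (-((n : ℤ) + 1))) - (u₁ • T ((n : ℤ) + 1) + (u₁ - u₁⁻¹) • T (-((n : ℤ) + 1))) ∈
      spanIcc K (-(n : ℤ)) n := by
  simpa only [one_mul, one_pow, mul_one] using
    h.isDL₁.apply_T_neg_sub_mem_spanIcc (.inl rfl) one_ne_zero (one_smul _ _).symm (by simp)
      h.map_one₁ n

theorem U₀_U₁_T (h : IsAskeyWilsonPair s₀ s₁ U₀ U₁ k u₀ u₁ v₀ v₁) (n : ℕ) :
    U₀ (U₁ (T ((n : ℤ) + 1))) - (u₀ * u₁ * k ^ (2 * (n + 1)))⁻¹ • T ((n : ℤ) + 1) ∈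
      spanIcc K (-(n : ℤ)) n := by
  have e : U₀ (U₁ (T ((n : ℤ) + 1))) - (u₀ * u₁ * k ^ (2 * (n + 1)))⁻¹ • T ((n : ℤ) + 1) =
      U₀ (U₁ (T ((n : ℤ) + 1)) - u₁⁻¹ • T (-((n : ℤ) + 1))) + u₁⁻¹ •
        (U₀ (T (-((n : ℤ) + 1))) - (u₀ * k ^ (2 * (n + 1)))⁻¹ • T ((n : ℤ) + 1)) := by
    rw [map_sub, map_smul]
    match_scalars <;> ring
  rw [e]
  exact add_mem (h.U₀_mem n (h.U₁_T n)) (Submodule.smul_mem _ _ (h.U₀_T_neg n))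

theorem exists_U₀_U₁_T_neg (h : IsAskeyWilsonPair s₀ s₁ U₀ U₁ k u₀ u₁ v₀ v₁) (n : ℕ) :
    ∃ c : K, U₀ (U₁ (T (-((n : ℤ) + 1)))) -
      ((u₀ * u₁ * k ^ (2 * (n + 1))) • T (-((n : ℤ) + 1)) + c • T ((n : ℤ) + 1)) ∈
      spanIcc K (-(n : ℤ)) n := by
  have key := add_mem (h.U₀_mem n (h.U₁_T_neg n))
    (add_mem (Submodule.smul_mem _ u₁ (h.U₀_T n))
      (Submodule.smul_mem _ (u₁ - u₁⁻¹) (h.U₀_T_neg n)))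
  refine ⟨u₁ * (u₀ - u₀⁻¹) + (u₁ - u₁⁻¹) * (u₀ * k ^ (2 * (n + 1)))⁻¹, ?_⟩
  convert key using 1
  rw [map_sub, map_add, map_smul, map_smul]
  module

theorem U₁_one (h : IsAskeyWilsonPair s₀ s₁ U₀ U₁ k u₀ u₁ v₀ v₁) : U₁ 1 = u₁ • 1 :=
  h.isDL₁.apply_of_map_eq h.map_one₁

theorem U₀_U₁_one (h : IsAskeyWilsonPair s₀ s₁ U₀ U₁ k u₀ u₁ v₀ v₁) :
    U₀ (U₁ 1) = (u₀ * u₁) • 1 := by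
  rw [h.U₁_one, map_smul, h.isDL₀.apply_of_map_eq h.map_one₀, smul_smul, mul_comm]

/-- By triangularity, `U₀ U₁` has only the expected eigenvalues. -/
theorem eq_zero_of_apply_eq (h : IsAskeyWilsonPair s₀ s₁ U₀ U₁ k u₀ u₁ v₀ v₁) {l : K} (n : ℕ)
    (hl : ∀ i ≤ n, l ≠ u₀ * u₁ * k ^ (2 * i))
    (hl' : ∀ i ≤ n, l ≠ (u₀ * u₁ * k ^ (2 * i))⁻¹)
    {f : LaurentPolynomial K} (hf : f ∈ spanIcc K (-(n : ℤ)) n) (hY : U₀ (U₁ f) = l • f) :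
    f = 0 := by
  induction n generalizing f with
  | zero =>
    obtain ⟨a, rfl⟩ : ∃ a : K, a • 1 = f := by
      rw [← Submodule.mem_span_singleton]
      simpa [spanIcc] using hf
    rw [map_smul, map_smul, h.U₀_U₁_one, smul_comm, ← sub_eq_zero, ← sub_smul] at hY
    have := sub_ne_zero.2 (hl 0 le_rfl).symm
    rw [mul_zero, pow_zero, mul_one] at this
    exact (smul_eq_zero.1 hY).resolve_left this
  | succ n ih =>
    push_cast at hf
    obtain ⟨a, b, r, hr, rfl⟩ := exists_of_mem_spanIcc_succ hf
    obtain ⟨c, hc⟩ := h.exists_U₀_U₁_T_neg n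
    have ht := h.U₀_U₁_T n
    have hr' := h.U₀_mem n (h.U₁_mem n hr)
    have hmem := sub_mem (add_mem (add_mem (Submodule.smul_mem _ a hc)
      (Submodule.smul_mem _ b ht)) hr') (Submodule.smul_mem _ l hr)
    obtain ⟨ha, hb⟩ := eq_zero_of_top_add_mem
      (a := a * (u₀ * u₁ * k ^ (2 * (n + 1)) - l))
      (b := a * c + b * ((u₀ * u₁ * k ^ (2 * (n + 1)))⁻¹ - l)) hmem (by
        rw [← sub_eq_zero] at hY
        rw [← hY]
        simp only [map_add, map_smul]
        module)
    have ha' : a = 0 := (mul_eq_zero.1 ha).resolve_right (sub_ne_zero.2 (hl _ le_rfl).symm)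
    subst ha'
    rw [zero_mul, zero_add] at hb
    have hb' : b = 0 := (mul_eq_zero.1 hb).resolve_right (sub_ne_zero.2 (hl' _ le_rfl).symm)
    subst hb'
    rw [zero_smul, zero_smul, zero_add, zero_add] at hY ⊢
    exact ih (fun i hi => hl i (hi.trans n.le_succ)) (fun i hi => hl' i (hi.trans n.le_succ)) hr hY

theorem U₁_sub_mem (h : IsAskeyWilsonPair s₀ s₁ U₀ U₁ k u₀ u₁ v₀ v₁) (m : ℕ)
    {f : LaurentPolynomial K} (hf : f - T (-(m : ℤ)) ∈ spanIcc K (-(m : ℤ) + 1) m) :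
    U₁ f - u₁ • T (m : ℤ) ∈ spanIcc K (-(m : ℤ)) (m - 1) := by
  have e : U₁ f - u₁ • T (m : ℤ) =
      U₁ (f - T (-(m : ℤ))) + (U₁ (T (-(m : ℤ))) - u₁ • T (m : ℤ)) := by
    rw [map_sub]; abel
  rw [e]
  cases m with
  | zero =>
    have hf0 : f - T (-((0 : ℕ) : ℤ)) = 0 := by simpa [spanIcc] using hf
    rw [hf0, map_zero, zero_add, Nat.cast_zero, neg_zero, T_zero, h.U₁_one, sub_self]
    exact zero_mem _
  | succ n =>
    push_cast at hf ⊢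
    have hmono : spanIcc K (-(n : ℤ)) n ≤ spanIcc K (-((n : ℤ) + 1)) (n + 1 - 1) :=
      spanIcc_mono (by lia) (by lia)
    have hT : T (-((n : ℤ) + 1)) ∈ spanIcc K (-((n : ℤ) + 1)) (n + 1 - 1) :=
      T_mem_spanIcc (by lia) (by lia)
    refine add_mem (map_mem_of_mem_spanIcc _ U₁ (fun j hj hj' => ?_) hf) ?_
    · rcases hj'.eq_or_lt with rfl | hj'
      · rw [← sub_add_cancel (U₁ _) (u₁⁻¹ • T (-((n : ℤ) + 1)))]
        exact add_mem (hmono (h.U₁_T n)) (Submodule.smul_mem _ _ hT)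
      · exact hmono (h.U₁_mem n (T_mem_spanIcc (by lia) (by lia)))
    · have key := add_mem (hmono (h.U₁_T_neg n)) (Submodule.smul_mem _ (u₁ - u₁⁻¹) hT)
      convert key using 1
      abel

theorem eval_U₁ (h : IsAskeyWilsonPair s₀ s₁ U₀ U₁ k u₀ u₁ v₀ v₁)
    (ev : LaurentPolynomial K →ₐ[K] K) (hev : ev (T 1) = (u₁ * v₁)⁻¹) (f : LaurentPolynomial K) :
    ev (U₁ f) = u₁ * ev f :=
  h.isDL₁.eval_apply h.u₁_ne h.v₁_ne ev hev f

/-- From the eigenfunction with leading term `T (-m)` to the one with leading term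
`T (m + 1)`. -/
theorem exists_raise_neg (h : IsAskeyWilsonPair s₀ s₁ U₀ U₁ k u₀ u₁ v₀ v₁)
    (ev : LaurentPolynomial K →ₐ[K] K) (hev : ev (T 1) = (u₁ * v₁)⁻¹) (m : ℕ)
    {f : LaurentPolynomial K} (hf : f - T (-(m : ℤ)) ∈ spanIcc K (-(m : ℤ) + 1) m)
    (hY : U₀ (U₁ f) = (u₀ * u₁ * k ^ (2 * m)) • f) :
    ∃ f', f' - T ((m : ℤ) + 1) ∈ spanIcc K (-(m : ℤ)) m ∧
      U₀ (U₁ f') = (u₀ * u₁ * k ^ (2 * (m + 1)))⁻¹ • f' ∧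
      ev f' = ev f * ((v₀ + k ^ (2 * m + 1) * u₀ * u₁ * v₁) *
        (1 - k ^ (2 * m + 1) * u₀ * u₁ * v₀ * v₁) /
          (u₁ * v₀ * v₁ * (1 - k ^ (2 * (2 * m + 1)) * (u₀ * u₁) ^ 2))) := by
  have hk := h.k_ne
  have hu₀ := h.u₀_ne
  have hu₁ := h.u₁_ne
  have hv₀ := h.v₀_ne
  have hv₁ := h.v₁_ne
  obtain ⟨l, hl⟩ : ∃ l, l = u₀ * u₁ * k ^ (2 * m) := ⟨_, rfl⟩
  have hl0 : l ≠ 0 := hl ▸ mul_ne_zero (mul_ne_zero hu₀ hu₁) (pow_ne_zero _ hk)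
  have hgen : k ^ 2 * l ^ 2 - 1 ≠ 0 := by
    have := sub_ne_zero.2 (h.generic_u (2 * m + 1))
    convert this using 2
    rw [hl]; ring
  rw [← hl] at hY
  obtain ⟨β, hβ⟩ : ∃ β, β = ((v₁ - v₁⁻¹) * k ^ 2 * l ^ 2 + (v₀ - v₀⁻¹) * k * l) /
    (k ^ 2 * l ^ 2 - 1) := ⟨_, rfl⟩
  have hβ' : -((v₁ - v₁⁻¹) * l) - (v₀ - v₀⁻¹) * k⁻¹ + β * l = (k ^ 2 * l)⁻¹ * β := by
    have h1 : β * (k ^ 2 * l ^ 2 - 1) = (v₁ - v₁⁻¹) * k ^ 2 * l ^ 2 + (v₀ - v₀⁻¹) * k * l := by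
      rw [hβ, div_mul_cancel₀ _ hgen]
    generalize v₁ - v₁⁻¹ = b₁ at *
    generalize v₀ - v₀⁻¹ = b₀ at *
    field_simp
    linear_combination h1
  refine ⟨u₁⁻¹ • (T 1 * U₁ f + β • f), ?_, ?_, ?_⟩
  · have hmem := T_mul_mem_spanIcc (a' := -(m : ℤ)) (b' := m) 1 (by lia) (by lia)
      (h.U₁_sub_mem m hf)
    have hfm : f ∈ spanIcc K (-(m : ℤ)) m := by
      rw [← sub_add_cancel f (T (-(m : ℤ)))]
      exact add_mem (spanIcc_mono (by lia) le_rfl hf) (T_mem_spanIcc le_rfl (by lia))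
    have key := Submodule.smul_mem _ u₁⁻¹ (add_mem hmem (Submodule.smul_mem _ β hfm))
    convert key using 1
    rw [add_comm (m : ℤ), T_add, mul_sub, mul_smul_comm]
    match_scalars <;> field_simp
  · have key := h.isDL₀.intertwine_shift h.isDL₁ hu₀ hu₁ hk rfl rfl hl0 hβ' hY
    rw [map_smul, map_smul, key, smul_comm, show k ^ 2 * l = u₀ * u₁ * k ^ (2 * (m + 1)) by
      rw [hl]; ring]
  · have hgen' : 1 - k ^ 2 * l ^ 2 ≠ 0 := by rwa [← neg_sub, neg_ne_zero]
    rw [map_smul, map_add, map_smul, map_mul, hev, h.eval_U₁ ev hev, hβ,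
      show k ^ (2 * m + 1) * u₀ * u₁ = k * l by rw [hl]; ring,
      show k ^ (2 * (2 * m + 1)) * (u₀ * u₁) ^ 2 = k ^ 2 * l ^ 2 by rw [hl]; ring]
    simp only [smul_eq_mul]
    field_simp
    ring

/-- From the eigenfunction with leading term `T (m + 1)` to the one with leading term
`T (-(m + 1))`. -/
theorem exists_raise_pos (h : IsAskeyWilsonPair s₀ s₁ U₀ U₁ k u₀ u₁ v₀ v₁)
    (ev : LaurentPolynomial K →ₐ[K] K) (hev : ev (T 1) = (u₁ * v₁)⁻¹) (m : ℕ)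
    {f : LaurentPolynomial K} (hf : f - T ((m : ℤ) + 1) ∈ spanIcc K (-(m : ℤ)) m)
    (hY : U₀ (U₁ f) = (u₀ * u₁ * k ^ (2 * (m + 1)))⁻¹ • f) :
    ∃ f', f' - T (-((m : ℤ) + 1)) ∈ spanIcc K (-(m : ℤ)) (m + 1) ∧
      U₀ (U₁ f') = (u₀ * u₁ * k ^ (2 * (m + 1))) • f' ∧
      ev f' = ev f * ((1 + k ^ (2 * (m + 1)) * u₁ ^ 2) *
        (1 - k ^ (2 * (m + 1)) * (u₀ * u₁) ^ 2) /
          (1 - k ^ (2 * (2 * m + 2)) * (u₀ * u₁) ^ 2)) := by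
  have hk := h.k_ne
  have hu₀ := h.u₀_ne
  have hu₁ := h.u₁_ne
  obtain ⟨l, hl⟩ : ∃ l, l = u₀ * u₁ * k ^ (2 * (m + 1)) := ⟨_, rfl⟩
  have hl0 : l ≠ 0 := hl ▸ mul_ne_zero (mul_ne_zero hu₀ hu₁) (pow_ne_zero _ hk)
  have hgen : l ^ 2 - 1 ≠ 0 := by
    have := sub_ne_zero.2 (h.generic_u (2 * m + 2))
    convert this using 2
    rw [hl]; ring
  rw [← hl] at hY ⊢
  obtain ⟨β, hβ⟩ : ∃ β, β = ((u₁ - u₁⁻¹) + (u₀ - u₀⁻¹) * l) / (l ^ 2 - 1) := ⟨_, rfl⟩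
  have hβ' : (u₁ - u₁⁻¹) * l⁻¹ + (u₀ - u₀⁻¹) + β * l⁻¹ = l⁻¹⁻¹ * β := by
    have h1 : β * (l ^ 2 - 1) = (u₁ - u₁⁻¹) + (u₀ - u₀⁻¹) * l := by
      rw [hβ, div_mul_cancel₀ _ hgen]
    generalize u₁ - u₁⁻¹ = b₁ at *
    generalize u₀ - u₀⁻¹ = b₀ at *
    field_simp
    linear_combination -h1
  refine ⟨u₁ • (U₁ f + β • f), ?_, ?_, ?_⟩
  · have hmono : spanIcc K (-(m : ℤ)) m ≤ spanIcc K (-(m : ℤ)) (m + 1) :=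
      spanIcc_mono le_rfl (by lia)
    have hfm : f ∈ spanIcc K (-(m : ℤ)) (m + 1) := by
      rw [← sub_add_cancel f (T ((m : ℤ) + 1))]
      exact add_mem (hmono hf) (T_mem_spanIcc (by lia) le_rfl)
    have key := Submodule.smul_mem _ u₁ (add_mem (hmono (add_mem (h.U₁_T m) (h.U₁_mem m hf)))
      (Submodule.smul_mem _ β hfm))
    convert key using 1
    rw [map_sub]
    match_scalars <;> field_simp; ring
  · have key := h.isDL₀.intertwine_inv h.isDL₁ hu₀ hu₁ (inv_ne_zero hl0) hβ' hY
    rw [map_smul, map_smul, key, smul_comm, inv_inv]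
  · have hgen' : 1 - l ^ 2 ≠ 0 := by rwa [← neg_sub, neg_ne_zero]
    rw [map_smul, map_add, map_smul, h.eval_U₁ ev hev, hβ,
      show k ^ (2 * (2 * m + 2)) * (u₀ * u₁) ^ 2 = l ^ 2 by rw [hl]; ring,
      show k ^ (2 * (m + 1)) * u₁ ^ 2 = l * u₁ / u₀ by rw [hl]; field_simp,
      show k ^ (2 * (m + 1)) * (u₀ * u₁) ^ 2 = l * (u₀ * u₁) by rw [hl]; ring]
    simp only [smul_eq_mul]
    field_simp
    ring

open Finset in
/-- Existence of the eigenfunction with leading term `T (-m)`, together with its evaluation. -/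
theorem exists_eigenfunction_neg (h : IsAskeyWilsonPair s₀ s₁ U₀ U₁ k u₀ u₁ v₀ v₁)
    (ev : LaurentPolynomial K →ₐ[K] K) (hev : ev (T 1) = (u₁ * v₁)⁻¹) (m : ℕ) :
    ∃ f, f - T (-(m : ℤ)) ∈ spanIcc K (-(m : ℤ) + 1) m ∧
      U₀ (U₁ f) = (u₀ * u₁ * k ^ (2 * m)) • f ∧
      ev f = ((u₁ * v₀ * v₁) ^ m)⁻¹ * ((∏ j ∈ range m, (1 + k ^ (2 * (j + 1)) * u₁ ^ 2)) /
        (∏ j ∈ range m, (1 - k ^ (2 * (m + 1 + j)) * (u₀ * u₁) ^ 2))) *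
        ∏ i ∈ range m, ((v₀ + k ^ (2 * i + 1) * u₀ * u₁ * v₁) *
          (1 - k ^ (2 * i + 1) * u₀ * u₁ * v₀ * v₁)) := by
  induction m with
  | zero => exact ⟨1, by simp, by simpa using h.U₀_U₁_one, by simp⟩
  | succ m ih =>
    obtain ⟨f, hf, hY, he⟩ := ih
    obtain ⟨g, hg, hYg, heg⟩ := h.exists_raise_neg ev hev m hf hY
    obtain ⟨f', hf', hYf', hef'⟩ := h.exists_raise_pos ev hev m hg hYg
    refine ⟨f', ?_, hYf', ?_⟩
    · push_cast
      rwa [neg_add, neg_add_cancel_right, ← neg_add]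
    · have hne (j : ℕ) : 1 - k ^ (2 * j) * (u₀ * u₁) ^ 2 ≠ 0 := sub_ne_zero.2 (h.generic_u j).symm
      have hprod : (∏ j ∈ range m, (1 - k ^ (2 * (m + 1 + j)) * (u₀ * u₁) ^ 2)) *
          (1 - k ^ (2 * (2 * m + 1)) * (u₀ * u₁) ^ 2) *
          (1 - k ^ (2 * (2 * m + 2)) * (u₀ * u₁) ^ 2) =
          (1 - k ^ (2 * (m + 1)) * (u₀ * u₁) ^ 2) *
          ∏ j ∈ range (m + 1), (1 - k ^ (2 * (m + 1 + 1 + j)) * (u₀ * u₁) ^ 2) := by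
        have shift (F : ℕ → K) : (∏ j ∈ range m, F j) * F m * F (m + 1) =
            (∏ j ∈ range (m + 1), F (j + 1)) * F 0 := by
          rw [← prod_range_succ, ← prod_range_succ, prod_range_succ']
        have e2 := shift (fun j => 1 - k ^ (2 * (m + 1 + j)) * (u₀ * u₁) ^ 2)
        convert e2 using 1
        · rw [show 2 * m + 1 = m + 1 + m by ring, show 2 * m + 2 = m + 1 + (m + 1) by ring]
        · rw [mul_comm]
          congr 1
          exact prod_congr rfl fun j _ => by congr 4; ring
      have hA : (∏ j ∈ range m, (1 - k ^ (2 * (m + 1 + j)) * (u₀ * u₁) ^ 2)) ≠ 0 :=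
        prod_ne_zero_iff.2 fun j _ => hne _
      have hB : (∏ j ∈ range (m + 1), (1 - k ^ (2 * (m + 1 + 1 + j)) * (u₀ * u₁) ^ 2)) ≠ 0 :=
        prod_ne_zero_iff.2 fun j _ => hne _
      have h1 := hne (2 * m + 1)
      have h2 := hne (2 * m + 2)
      have hu₁ := h.u₁_ne
      have hv₀ := h.v₀_ne
      have hv₁ := h.v₁_ne
      rw [hef', heg, he, prod_range_succ (fun j => 1 + k ^ (2 * (j + 1)) * u₁ ^ 2),
        prod_range_succ (fun i => (v₀ + k ^ (2 * i + 1) * u₀ * u₁ * v₁) *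
          (1 - k ^ (2 * i + 1) * u₀ * u₁ * v₀ * v₁))]
      generalize (∏ j ∈ range m, (1 - k ^ (2 * (m + 1 + j)) * (u₀ * u₁) ^ 2)) = A at *
      generalize (∏ j ∈ range (m + 1), (1 - k ^ (2 * (m + 1 + 1 + j)) * (u₀ * u₁) ^ 2)) = B at *
      generalize 1 - k ^ (2 * (2 * m + 1)) * (u₀ * u₁) ^ 2 = c₁ at *
      generalize 1 - k ^ (2 * (2 * m + 2)) * (u₀ * u₁) ^ 2 = c₂ at *
      generalize 1 - k ^ (2 * (m + 1)) * (u₀ * u₁) ^ 2 = c₃ at *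
      generalize (∏ j ∈ range m, (1 + k ^ (2 * (j + 1)) * u₁ ^ 2)) = P
      generalize (∏ i ∈ range m, ((v₀ + k ^ (2 * i + 1) * u₀ * u₁ * v₁) *
          (1 - k ^ (2 * i + 1) * u₀ * u₁ * v₀ * v₁))) = Q
      generalize (v₀ + k ^ (2 * m + 1) * u₀ * u₁ * v₁) *
          (1 - k ^ (2 * m + 1) * u₀ * u₁ * v₀ * v₁) = r
      generalize 1 + k ^ (2 * (m + 1)) * u₁ ^ 2 = t
      have hc : c₃ / (A * c₁ * c₂) = B⁻¹ := by
        rw [hprod, div_mul_cancel_left₀]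
        rintro rfl
        rw [zero_mul] at hprod
        exact mul_ne_zero (mul_ne_zero hA h1) h2 hprod
      calc _ = ((u₁ * v₀ * v₁) ^ (m + 1))⁻¹ * (P * t) * (c₃ / (A * c₁ * c₂)) * (Q * r) := by
            field_simp
            ring
        _ = _ := by rw [hc]; ring

open Finset in
/-- The evaluation formula for an eigenfunction with leading term `T (m + 1)`. -/
theorem eval_eigenfunction (h : IsAskeyWilsonPair s₀ s₁ U₀ U₁ k u₀ u₁ v₀ v₁)
    (ev : LaurentPolynomial K →ₐ[K] K) (hev : ev (T 1) = (u₁ * v₁)⁻¹) (m : ℕ)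
    {f : LaurentPolynomial K} (hf : f - T ((m : ℤ) + 1) ∈ spanIcc K (-(m : ℤ)) m)
    (hY : U₀ (U₁ f) = (u₀ * u₁ * k ^ (2 * (m + 1)))⁻¹ • f) :
    ev f = ((u₁ * v₀ * v₁) ^ (m + 1))⁻¹ * ((∏ j ∈ range m, (1 + k ^ (2 * (j + 1)) * u₁ ^ 2)) /
        (∏ j ∈ range (m + 1), (1 - k ^ (2 * (m + 1 + j)) * (u₀ * u₁) ^ 2))) *
        ∏ i ∈ range (m + 1), ((v₀ + k ^ (2 * i + 1) * u₀ * u₁ * v₁) *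
          (1 - k ^ (2 * i + 1) * u₀ * u₁ * v₀ * v₁)) := by
  obtain ⟨g, hg, hYg, heg⟩ := h.exists_eigenfunction_neg ev hev m
  obtain ⟨f', hf', hYf', hef'⟩ := h.exists_raise_neg ev hev m hg hYg
  have hne : u₀ * u₁ ≠ 0 := mul_ne_zero h.u₀_ne h.u₁_ne
  have hff' : f - f' = 0 := by
    refine h.eq_zero_of_apply_eq (l := (u₀ * u₁ * k ^ (2 * (m + 1)))⁻¹) m ?_ ?_ ?_ ?_
    · intro i hi heq
      apply h.generic_u (m + 1 + i)
      have h1 : u₀ * u₁ * k ^ (2 * i) * (u₀ * u₁ * k ^ (2 * (m + 1))) = 1 := by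
        rw [← heq]
        exact inv_mul_cancel₀ (mul_ne_zero hne (pow_ne_zero _ h.k_ne))
      rw [← h1]; ring
    · intro i hi heq
      obtain ⟨d, rfl⟩ := Nat.exists_eq_add_of_le hi
      apply h.generic_k d
      have h1 := mul_left_cancel₀ hne (inv_injective heq)
      apply mul_left_cancel₀ (pow_ne_zero (2 * i) h.k_ne)
      rw [mul_one]
      exact Eq.trans (by ring) h1
    · convert sub_mem hf hf' using 1
      abel
    · rw [map_sub, map_sub, hY, hYf', smul_sub]
  rw [sub_eq_zero.1 hff', hef', heg, prod_range_succ _ m, prod_range_succ _ m,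
    show m + 1 + m = 2 * m + 1 by ring, pow_succ]
  simp only [div_eq_mul_inv, mul_inv]
  ring

end IsAskeyWilsonPair

namespace F

theorem algebraMap_injective :
    Function.Injective (algebraMap (MvPolynomial (Fin 5) ℚ) F) :=
  IsFractionRing.injective _ _

theorem algebraMap_X_ne_zero (i : Fin 5) :
    algebraMap (MvPolynomial (Fin 5) ℚ) F (MvPolynomial.X i) ≠ 0 :=
  (map_ne_zero_iff _ algebraMap_injective).2 (MvPolynomial.X_ne_zero i)

theorem algebraMap_ne_one {p : MvPolynomial (Fin 5) ℚ} (hp : MvPolynomial.eval 0 p = 0) :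
    algebraMap (MvPolynomial (Fin 5) ℚ) F p ≠ 1 := by
  intro h
  rw [← map_one (algebraMap (MvPolynomial (Fin 5) ℚ) F)] at h
  rw [algebraMap_injective h, map_one] at hp
  exact one_ne_zero hp

end F

open LaurentPolynomial in

theorem isAskeyWilsonPair {s U : Fin 2 → Module.End F LF} (hs : Sconds s) (hU : Uconds s U) :
    IsAskeyWilsonPair (s 0) (s 1) (U 0) (U 1) F.q4 F.u0h F.u1h F.v0h F.v1h where
  isDL₀ := by
    have hq : F.q4 ≠ 0 := F.algebraMap_X_ne_zero 0
    refine isDemazureLusztig_of_flip (c := F.q4) (d := F.q2) (e := -1) (Or.inr rfl) hq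
      (pow_ne_zero 2 hq) ?_ rfl (by rw [neg_neg]) hs.2 fun f g hg => ?_
    · rw [F.q2, zpow_neg_one]
      field_simp
    · have hX : Xl 0 = F.q4 • (T (-1) : LF) := (smul_eq_C_mul _ _).symm
      have e := hU 0 f g (by rw [hX]; exact hg)
      rw [e, hX, add_mul, mul_assoc, ← smul_eq_C_mul, ← smul_eq_C_mul, ← add_assoc]
      rfl
  isDL₁ := by
    refine isDemazureLusztig_of_flip (c := 1) (d := 1) (e := 1) (Or.inl rfl) one_ne_zero
      one_ne_zero (by simp) (by simp) (by simp) (fun n => by simpa using hs.1 n)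
      fun f g hg => ?_
    have e := hU 1 f g hg
    rw [e, add_mul, mul_assoc, ← smul_eq_C_mul, ← smul_eq_C_mul, ← add_assoc]
    rfl
  map_one₀ := by simpa using hs.2 0
  map_one₁ := by simpa using hs.1 0
  k_ne := F.algebraMap_X_ne_zero 0
  u₀_ne := F.algebraMap_X_ne_zero 1
  u₁_ne := F.algebraMap_X_ne_zero 2
  v₀_ne := F.algebraMap_X_ne_zero 3
  v₁_ne := F.algebraMap_X_ne_zero 4
  generic_u n := by
    simp only [F.q4, F.u0h, F.u1h, ← map_mul, ← map_pow]
    exact F.algebraMap_ne_one (by simp)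
  generic_k n := by
    simp only [F.q4, ← map_pow]
    exact F.algebraMap_ne_one (by simp)

open LaurentPolynomial Finset in
/-- evaluation formula: if `f = 𝕏^{m+1} + Σ_{j=−m}^{m} c_j·𝕏^j` satisfies
`Ŷ(f) = (u₀u₁)^{−1/2}·q^{−(m+1)/2}·f`, then its evaluation at `𝕏 = u₁^{−1/2}·v₁^{−1/2}`
equals the stated product. -/
theorem statement18 :
    ∀ s U : Fin 2 → Module.End F LF, Sconds s → Uconds s U →
    ∀ (m : ℕ) (f : LF),
      (∃ c : ℤ → F, f = T ((m : ℤ) + 1) + ∑ j ∈ Icc (-(m : ℤ)) (m : ℤ), C (c j) * T j) →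
      U 0 (U 1 f) = ((F.u0h * F.u1h)⁻¹ * F.q2 ^ (-((m : ℤ) + 1))) • f →
      ∀ ev : LF →ₐ[F] F, ev (T 1) = (F.u1h * F.v1h)⁻¹ →
        ev f = (F.u1h * F.v0h * F.v1h) ^ (-((m : ℤ) + 1)) *
          ((∏ j ∈ Icc 1 m, (1 + F.q2 ^ j * F.u1)) /
            (∏ j ∈ Icc (m + 1) (2 * m + 1), (1 - F.q2 ^ j * F.u0 * F.u1))) *
          ∏ i ∈ range (m + 1),
            ((F.v0h + F.q4 ^ (2 * i + 1) * F.u0h * F.u1h * F.v1h) *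
              (1 - F.q4 ^ (2 * i + 1) * F.u0h * F.u1h * F.v0h * F.v1h)) := by
  intro s U hs hU m f ⟨c, hf⟩ hY ev hev
  have h := isAskeyWilsonPair hs hU
  have hmem : f - T ((m : ℤ) + 1) ∈ spanIcc F (-(m : ℤ)) m := by
    rw [hf, add_sub_cancel_left]
    refine Submodule.sum_mem _ fun j hj => ?_
    rw [← smul_eq_C_mul]
    exact Submodule.smul_mem _ _ (T_mem_spanIcc (mem_Icc.1 hj).1 (mem_Icc.1 hj).2)
  have hzpow (x : F) : x ^ (-((m : ℤ) + 1)) = (x ^ (m + 1))⁻¹ := by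
    rw [zpow_neg, ← Nat.cast_succ, zpow_natCast]
  have heig : (F.u0h * F.u1h)⁻¹ * F.q2 ^ (-((m : ℤ) + 1)) =
      (F.u0h * F.u1h * F.q4 ^ (2 * (m + 1)))⁻¹ := by
    rw [hzpow, F.q2, ← pow_mul, ← mul_inv]
  rw [heig] at hY
  have hnum : ∏ j ∈ Icc 1 m, (1 + F.q2 ^ j * F.u1) =
      ∏ j ∈ range m, (1 + F.q4 ^ (2 * (j + 1)) * F.u1h ^ 2) := by
    rw [← Ico_add_one_right_eq_Icc, prod_Ico_eq_prod_range, Nat.add_sub_cancel]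
    refine prod_congr rfl fun j _ => ?_
    rw [F.q2, F.u1, ← pow_mul, add_comm 1 j]
  have hden : ∏ j ∈ Icc (m + 1) (2 * m + 1), (1 - F.q2 ^ j * F.u0 * F.u1) =
      ∏ j ∈ range (m + 1), (1 - F.q4 ^ (2 * (m + 1 + j)) * (F.u0h * F.u1h) ^ 2) := by
    rw [← Ico_add_one_right_eq_Icc, prod_Ico_eq_prod_range,
      show 2 * m + 1 + 1 - (m + 1) = m + 1 by omega]
    refine prod_congr rfl fun j _ => ?_
    rw [F.q2, F.u0, F.u1, ← pow_mul, mul_pow, mul_assoc]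
  rw [hzpow, hnum, hden]
  exact h.eval_eigenfunction ev hev m hmem hY
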